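/- (Proposition 2.13, triangulated form.) Let C be a pretriangulated category satisfying the octahedral axiom (Mathlib's CategoryTheory.IsTriangulated) and S a set of objects of C. For an object X of C, the following are equivalent: (i) every triangulated-closed property of objects of C that holds for all objects of S holds for X (equivalently, X lies in the smallest strictly full triangulated subcategory of C containing S); (ii) X admits an S-tower, i.e., there exist objects X = X₀, X₁, …, Xₙ with Xₙ isomorphic to a zero object and, for each 0 ≤ i ≤ n−1, an integer aᵢ, an object Dᵢ ∈ S, and a distinguished triangle Dᵢ⟦aᵢ⟧ ⟶ X_{i+1} ⟶ Xᵢ ⟶ (Dᵢ⟦aᵢ⟧)⟦1⟧. -/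

import Mathlib

open CategoryTheory CategoryTheory.Limits CategoryTheory.Pretriangulated

universe v u

variable {C : Type u} [Category.{v} C] [HasZeroObject C] [HasShift C ℤ]
  [Preadditive C] [∀ n : ℤ, (shiftFunctor C n).Additive] [Pretriangulated C]

/-- An object `X` admits an `S`-tower if there are objects `X = X₀, X₁, …, Xₙ`
with `Xₙ` (isomorphic to) a zero object, and for each `0 ≤ i ≤ n - 1` an integer `aᵢ`,
an object `Dᵢ ∈ S` and a distinguished triangle `Dᵢ⟦aᵢ⟧ ⟶ X_{i+1} ⟶ Xᵢ ⟶ (Dᵢ⟦aᵢ⟧)⟦1⟧`. -/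
def HasTower (S : Set C) (X : C) : Prop :=
  ∃ (n : ℕ) (Y : Fin (n + 1) → C), Y 0 = X ∧ IsZero (Y (Fin.last n)) ∧
    ∀ i : Fin n, ∃ (a : ℤ) (D : C), D ∈ S ∧
      ∃ (f : (D⟦a⟧) ⟶ Y i.succ) (g : Y i.succ ⟶ Y i.castSucc)
        (h : Y i.castSucc ⟶ (D⟦a⟧)⟦(1 : ℤ)⟧),
        Triangle.mk f g h ∈ distTriang C

/-- A property `P` of objects of `C` is triangulated-closed if it is closed under
isomorphism, holds for the zero object, is closed under all shifts, and for every
distinguished triangle `A ⟶ B ⟶ C ⟶ A⟦1⟧`, `P A` and `P C` imply `P B`. -/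
def TriangClosed (P : C → Prop) : Prop :=
  (∀ ⦃X Y : C⦄, (X ≅ Y) → P X → P Y) ∧
  (∀ X : C, IsZero X → P X) ∧
  (∀ (X : C) (a : ℤ), P X → P (X⟦a⟧)) ∧
  (∀ T : Triangle C, T ∈ (distTriang C) → P T.obj₁ → P T.obj₃ → P T.obj₂)

lemma mk_mem_distTriang_of_iso {X₁ X₂ X₃ Y₁ Y₂ Y₃ : C}
    {f : X₁ ⟶ X₂} {g : X₂ ⟶ X₃} {h : X₃ ⟶ X₁⟦(1 : ℤ)⟧}
    {f' : Y₁ ⟶ Y₂} {g' : Y₂ ⟶ Y₃} {h' : Y₃ ⟶ Y₁⟦(1 : ℤ)⟧}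
    (hT : Triangle.mk f g h ∈ distTriang C) (e₁ : Y₁ ≅ X₁) (e₂ : Y₂ ≅ X₂) (e₃ : Y₃ ≅ X₃)
    (comm₁ : f' ≫ e₂.hom = e₁.hom ≫ f) (comm₂ : g' ≫ e₃.hom = e₂.hom ≫ g)
    (comm₃ : h' ≫ e₁.hom⟦(1 : ℤ)⟧' = e₃.hom ≫ h) :
    Triangle.mk f' g' h' ∈ distTriang C :=
  isomorphic_distinguished _ hT _ (Triangle.isoMk _ _ e₁ e₂ e₃ comm₁ comm₂ comm₃)

namespace HasTower

variable {S : Set C}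

lemma of_isZero {X : C} (hX : IsZero X) : HasTower S X :=
  ⟨0, fun _ => X, rfl, hX, fun i => i.elim0⟩

lemma of_distTriang {D X' X : C} (hD : D ∈ S) {a : ℤ} {f : D⟦a⟧ ⟶ X'} {g : X' ⟶ X}
    {h : X ⟶ (D⟦a⟧)⟦(1 : ℤ)⟧} (hT : Triangle.mk f g h ∈ distTriang C) (hX' : HasTower S X') :
    HasTower S X := by
  obtain ⟨n, Y, rfl, hzero, hstep⟩ := hX'
  refine ⟨n + 1, Fin.cons X Y, rfl, hzero, fun i => ?_⟩
  induction i using Fin.cases with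
  | zero => exact ⟨a, D, hD, f, g, h, hT⟩
  | succ i => exact hstep i

@[elab_as_elim]
lemma induction {motive : (X : C) → HasTower S X → Prop}
    (zero : ∀ (X : C) (hX : IsZero X), motive X (of_isZero hX))
    (step : ∀ (D X' X : C) (a : ℤ) (f : D⟦a⟧ ⟶ X') (g : X' ⟶ X) (h : X ⟶ (D⟦a⟧)⟦(1 : ℤ)⟧)
      (hD : D ∈ S) (hT : Triangle.mk f g h ∈ distTriang C) (hX' : HasTower S X'),
      motive X' hX' → motive X (of_distTriang hD hT hX'))
    {X : C} (hX : HasTower S X) : motive X hX := by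
  obtain ⟨n, Y, rfl, hzero, hstep⟩ := hX
  induction n with
  | zero => exact zero _ hzero
  | succ n ih =>
    obtain ⟨a, D, hD, f, g, h, hT⟩ := hstep 0
    exact step D _ _ a f g h hD hT
      ⟨n, fun i => Y i.succ, rfl, hzero, fun i => hstep i.succ⟩
      (ih (fun i => Y i.succ) hzero fun i => hstep i.succ)

lemma of_iso {X X₁ : C} (e : X ≅ X₁) (hX : HasTower S X) : HasTower S X₁ := by
  induction hX using induction with
  | zero X hX => exact of_isZero (hX.of_iso e.symm)
  | step D X' X a f g h hD hT hX' _ =>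
    refine of_distTriang hD (f := f) (g := g ≫ e.hom) (h := e.inv ≫ h) ?_ hX'
    exact mk_mem_distTriang_of_iso hT (Iso.refl _) (Iso.refl _) e.symm
      (by simp) (by simp) (by simp)

lemma of_distTriang_of_iso {D : C} (hD : D ∈ S) {a : ℤ} {T : Triangle C}
    (hT : T ∈ distTriang C) (e : T.obj₁ ≅ D⟦a⟧) (h₂ : HasTower S T.obj₂) :
    HasTower S T.obj₃ := by
  refine of_distTriang hD (f := e.inv ≫ T.mor₁) (g := T.mor₂)
    (h := T.mor₃ ≫ e.hom⟦(1 : ℤ)⟧') ?_ h₂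
  exact mk_mem_distTriang_of_iso hT e.symm (Iso.refl _) (Iso.refl _)
    (by simp) (by simp) (by simp [← Functor.map_comp])

lemma of_mem {D : C} (hD : D ∈ S) : HasTower S D :=
  of_iso ((shiftFunctorCompIsoId C (-1 : ℤ) 1 (by lia)).app D)
    (of_distTriang hD (contractible_distinguished₂ (D⟦(-1 : ℤ)⟧)) (of_isZero (isZero_zero C)))

lemma shift {X : C} (hX : HasTower S X) (b : ℤ) : HasTower S (X⟦b⟧) := by
  induction hX using induction with
  | zero X hX => exact of_isZero ((shiftFunctor C b).map_isZero hX)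
  | step D X' X a f g h hD hT _ ih =>
    exact of_distTriang_of_iso hD (Triangle.shift_distinguished _ hT b)
      ((shiftFunctorAdd C a b).app D).symm ih

lemma of_extension [IsTriangulated C] {A B X : C} {f : A ⟶ B} {g : B ⟶ X} {h : X ⟶ A⟦(1 : ℤ)⟧}
    (hT : Triangle.mk f g h ∈ distTriang C) (hA : HasTower S A) (hX : HasTower S X) :
    HasTower S B := by
  induction hX using induction generalizing B with
  | zero X hX =>
    have : IsIso f := (Triangle.isZero₃_iff_isIso₁ _ hT).1 hX
    exact of_iso (asIso f) hA
  | step D X' X a u v w hD hT' _ ih =>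
    obtain ⟨B', p, q, hT''⟩ := distinguished_cocone_triangle₁ (g ≫ w)
    have o := Triangulated.someOctahedron' rfl hT (rot_of_distTriang _ hT') hT''
    exact of_distTriang_of_iso hD (inv_rot_of_distTriang _ hT'')
      ((shiftFunctorCompIsoId C (1 : ℤ) (-1) (by lia)).app _) (ih o.mem)

lemma triangClosed [IsTriangulated C] (S : Set C) : TriangClosed (HasTower S) :=
  ⟨fun _ _ e hX => hX.of_iso e, fun _ hX => of_isZero hX, fun _ a hX => hX.shift a,
    fun _ hT h₁ h₃ => of_extension hT h₁ h₃⟩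

end HasTower

lemma TriangClosed.prop_of_hasTower {P : C → Prop} (hP : TriangClosed P) {S : Set C}
    (hS : ∀ D ∈ S, P D) {X : C} (hX : HasTower S X) : P X := by
  obtain ⟨-, hzero, hshift, hext⟩ := hP
  induction hX using HasTower.induction with
  | zero X hX => exact hzero X hX
  | step D X' X a f g h hD hT _ ih =>
    exact hext _ (rot_of_distTriang _ hT) ih (hshift _ 1 (hshift D a (hS D hD)))

/-- Proposition 2.13 (triangulated form): `X` lies in the smallest strictly full
triangulated subcategory of `C` containing `S` (i.e. every triangulated-closed
property holding on `S` holds for `X`) if and only if `X` admits an `S`-tower. -/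
theorem generated_iff_hasTower [IsTriangulated C] (S : Set C) (X : C) :
    (∀ P : C → Prop, TriangClosed P → (∀ D ∈ S, P D) → P X) ↔ HasTower S X := by
  exact ⟨fun h => h _ (HasTower.triangClosed S) fun _ hD => HasTower.of_mem hD,
    fun hX _ hP hS => hP.prop_of_hasTower hS hX⟩
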